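/- Let (W,S) be a Coxeter system, z ∈ W, and s,t ∈ S with s·z = z·t > z. Then there exists a reduced expression z̃ of z such that the word (s, z̃) can be transformed into the word (z̃, t) by a 'sweep': a sequence of single applications of braid relations proceeding left to right, i.e. the first braid relation applied to letters 1,…,m₁, the next to letters starting at position m₁, and so on to the end of the word. -/

import Mathlib

/-- The braid word: the alternating word in `i`, `j` of length `M i j` (ending in `j`). -/
def braidWord {B : Type} (M : CoxeterMatrix B) (i j : B) : List B :=
  CoxeterSystem.alternatingWord i j (M.M i j)

/-- `SweepFrom M a w w'` : the word `w` can be transformed into `w'` by a "sweep"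
starting at position `a.length`, i.e. a sequence of single applications of braid
relations proceeding left to right: each braid relation is applied to a window of
consecutive letters beginning at the last letter of the previous window, and the
final window reaches the end of the word. -/
inductive SweepFrom {B : Type} (M : CoxeterMatrix B) : List B → List B → List B → Prop
  | last (a : List B) (i j : B) :
      SweepFrom M a (a ++ braidWord M i j) (a ++ braidWord M j i)
  | step (a c w' : List B) (i j : B) :
      SweepFrom M (a ++ braidWord M j i).dropLast (a ++ braidWord M j i ++ c) w' →
      SweepFrom M a (a ++ braidWord M i j ++ c) w'

namespace CoxeterSystem

section GeometricRepresentation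

open Polynomial.Chebyshev Module

variable {B W : Type*} [Group W] (M : CoxeterMatrix B)

/-- The simple coroot `α_i^∨` of the geometric representation on `B →₀ ℝ`. It satisfies
`α_i^∨ (α_j) = -2 cos (π / M i j)`; the convention `π / 0 = 0` handles infinite labels. -/
noncomputable def simpleCoroot (i : B) : Dual ℝ (B →₀ ℝ) :=
  Finsupp.linearCombination ℝ fun j ↦ -2 * Real.cos (Real.pi / M i j)

theorem simpleCoroot_single (i j : B) :
    simpleCoroot M i (Finsupp.single j 1) = -2 * Real.cos (Real.pi / M i j) := by
  simp [simpleCoroot]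

theorem simpleCoroot_single_self (i : B) : simpleCoroot M i (Finsupp.single i 1) = 2 := by
  simp [simpleCoroot_single]

/-- The simple reflections of the geometric representation. -/
noncomputable def simpleReflection (i : B) : (B →₀ ℝ) ≃ₗ[ℝ] (B →₀ ℝ) :=
  reflection (simpleCoroot_single_self M i)

theorem simpleCoroot_mul_simpleCoroot (i j : B) :
    2 * Real.cos (2 * Real.pi / M i j) =
      simpleCoroot M i (Finsupp.single j 1) * simpleCoroot M j (Finsupp.single i 1) - 2 := by
  rw [simpleCoroot_single, simpleCoroot_single, M.symmetric j i, mul_div_assoc, Real.cos_two_mul]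
  ring

theorem sin_two_pi_div_pos {m : ℕ} (hm : 3 ≤ m) : 0 < Real.sin (2 * Real.pi / m) := by
  have hm' : (3 : ℝ) ≤ m := by exact_mod_cast hm
  apply Real.sin_pos_of_pos_of_lt_pi
  · have := Real.pi_pos
    positivity
  · rw [div_lt_iff₀ (by linarith)]
    nlinarith [Real.pi_pos]

theorem eval_S_two_mul_cos {θ : ℝ} (hθ : Real.sin θ ≠ 0) (n : ℤ) :
    (S ℝ n).eval (2 * Real.cos θ) = Real.sin ((n + 1) * θ) / Real.sin θ :=
  eq_div_of_mul_eq hθ (S_two_mul_real_cos θ n)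

theorem isLiftable_simpleReflection : M.IsLiftable (simpleReflection M) := by
  intro i j
  rcases eq_or_ne i j with rfl | hij
  · ext1 v
    simpa [simpleReflection] using involutive_reflection (simpleCoroot_single_self M i) v
  ext1 v
  obtain h0 | h2 | h3 : M i j = 0 ∨ M i j = 2 ∨ 3 ≤ M i j := by
    have := M.off_diagonal i j hij
    omega
  · simp [h0]
  · have hi : simpleCoroot M i (Finsupp.single j 1) = 0 := by
      rw [simpleCoroot_single]; simp [h2]
    have hj : simpleCoroot M j (Finsupp.single i 1) = 0 := by
      rw [simpleCoroot_single, M.symmetric j i]; simp [h2]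
    simp only [h2, pow_two, LinearEquiv.mul_apply, simpleReflection, reflection_apply, map_sub,
      map_smul, hi, hj, simpleCoroot_single_self]
    change _ = v
    module
  · have hm0 : (M i j : ℝ) ≠ 0 := by
      have : M i j ≠ 0 := by omega
      exact_mod_cast this
    have hsin := (sin_two_pi_div_pos h3).ne'
    rw [simpleReflection, simpleReflection, reflection_mul_reflection_pow_apply _ _ _ _ _
      (simpleCoroot_mul_simpleCoroot M i j)]
    simp only [eval_S_two_mul_cos hsin]
    obtain ⟨k, hk⟩ | ⟨k, hk⟩ := Nat.even_or_odd (M i j)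
    · have e1 : ((M i j : ℤ) - 2) / 2 = k - 1 := by omega
      have e2 : ((M i j : ℤ) - 1) / 2 = k - 1 := by omega
      have e3 : Real.sin ((((k - 1 : ℤ) : ℝ) + 1) * (2 * Real.pi / M i j)) = 0 := by
        rw [← Real.sin_pi]
        congr 1
        have : (M i j : ℝ) = k + k := by exact_mod_cast hk
        field_simp
        push_cast
        linarith
      simp only [e1, e2, e3, zero_div, zero_mul, zero_smul, add_zero, LinearEquiv.coe_one, id_eq]
    · have e1 : ((M i j : ℤ) - 2) / 2 = k - 1 := by omega
      have e2 : ((M i j : ℤ) - 1) / 2 = k := by omega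
      have e4 : ((M i j : ℤ) - 3) / 2 = k - 1 := by omega
      have e5 : (M i j : ℤ) / 2 = k := by omega
      have e3 : Real.sin (((k : ℤ) + 1 : ℝ) * (2 * Real.pi / M i j)) / Real.sin (2 * Real.pi / M i j)
          + Real.sin ((((k - 1 : ℤ) : ℝ) + 1) * (2 * Real.pi / M i j))
            / Real.sin (2 * Real.pi / M i j) = 0 := by
        have : ((k : ℤ) + 1 : ℝ) * (2 * Real.pi / M i j) =
            2 * Real.pi - (((k - 1 : ℤ) : ℝ) + 1) * (2 * Real.pi / M i j) := by
          have : (M i j : ℝ) = 2 * k + 1 := by exact_mod_cast hk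
          field_simp
          push_cast
          linarith
        rw [this, Real.sin_two_pi_sub]
        ring
      simp only [e1, e2, e4, e5, e3, mul_zero, zero_smul, add_zero, LinearEquiv.coe_one, id_eq]

theorem simpleReflection_mul_pow_ne_one {i j : B} (hij : i ≠ j) {k : ℕ} (hk : 0 < k)
    (hkM : M i j = 0 ∨ k < M i j) :
    (simpleReflection M i * simpleReflection M j) ^ k ≠ 1 := by
  intro h
  have hx := congrArg (fun e : (B →₀ ℝ) ≃ₗ[ℝ] (B →₀ ℝ) ↦ e (Finsupp.single i 1)) h
  simp only [simpleReflection] at hx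
  rw [reflection_mul_reflection_pow_apply_self _ _ _ _ (simpleCoroot_mul_simpleCoroot M i j)] at hx
  have hxi := DFunLike.congr_fun hx i
  have hxj := DFunLike.congr_fun hx j
  simp only [LinearEquiv.coe_one, id_eq, Finsupp.coe_add, Finsupp.coe_smul, Pi.add_apply,
    Pi.smul_apply, Finsupp.single_eq_same, Finsupp.single_eq_of_ne hij,
    Finsupp.single_eq_of_ne hij.symm, smul_eq_mul, mul_one, mul_zero, add_zero, zero_add,
    simpleCoroot_single, M.symmetric j i] at hxi hxj
  obtain h0 | h2 | h3 : M i j = 0 ∨ M i j = 2 ∨ 3 ≤ M i j := by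
    have := M.off_diagonal i j hij
    omega
  · simp [h0, S_eval_two] at hxj
    omega
  · obtain rfl : k = 1 := by omega
    norm_num [h2] at hxi
  · have hm : (3 : ℝ) ≤ M i j := by exact_mod_cast h3
    have hsin := sin_two_pi_div_pos h3
    have hcos : 0 < Real.cos (Real.pi / M i j) := by
      apply Real.cos_pos_of_mem_Ioo
      have h : Real.pi / M i j < Real.pi / 2 :=
        div_lt_div_of_pos_left Real.pi_pos two_pos (by linarith)
      have h' : 0 < Real.pi / M i j := div_pos Real.pi_pos (by linarith)
      constructor <;> linarith
    have hkM' : (k : ℝ) < M i j := by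
      have : k < M i j := by omega
      exact_mod_cast this
    have hk' : (0 : ℝ) < k := by exact_mod_cast hk
    set θ := 2 * Real.pi / M i j with hθ
    simp only [eval_S_two_mul_cos hsin.ne'] at hxi hxj
    have hsk : Real.sin (k * θ) = 0 := by
      push_cast at hxj
      simpa [hsin.ne', hcos.ne'] using hxj
    have hkθ : 0 < k * θ := mul_pos hk' (div_pos Real.two_pi_pos (by linarith))
    have hkθ' : k * θ < 2 * Real.pi := by
      rw [hθ, ← mul_div_assoc, div_lt_iff₀ (by linarith)]
      nlinarith [Real.pi_pos]
    have hck : Real.cos (k * θ) ≠ 1 := by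
      rw [Ne, Real.cos_eq_one_iff_of_lt_of_lt (by linarith) hkθ']
      exact hkθ.ne'
    push_cast at hxi
    rw [sub_add_cancel, hsk, zero_div, add_zero, add_mul, one_mul, Real.sin_add, hsk, zero_mul,
      zero_add, mul_div_cancel_right₀ _ hsin.ne'] at hxi
    exact hck hxi

variable {M} (cs : CoxeterSystem M W)

theorem simple_mul_simple_pow_ne_one {i j : B} (hij : i ≠ j) {k : ℕ} (hk : 0 < k)
    (hkM : M i j = 0 ∨ k < M i j) : (cs.simple i * cs.simple j) ^ k ≠ 1 := by
  intro h
  apply simpleReflection_mul_pow_ne_one M hij hk hkM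
  simpa [lift_apply_simple] using
    congrArg (cs.lift ⟨simpleReflection M, isLiftable_simpleReflection M⟩) h

theorem simple_injective : Function.Injective cs.simple := by
  intro i j h
  by_contra hij
  have := M.off_diagonal i j hij
  exact cs.simple_mul_simple_pow_ne_one hij one_pos (by omega) (by simp [h])

end GeometricRepresentation

section InversionCocycle

open scoped Classical in
/-- The permutation `(t, ε) ↦ (s t s, ε + [t = s])` of `W × ZMod 2` attached to the simple
reflection `s = s i`. -/
noncomputable def inversionPerm {B W : Type*} [Group W] {M : CoxeterMatrix B}
    (cs : CoxeterSystem M W) (i : B) : Equiv.Perm (W × ZMod 2) :=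
  Function.Involutive.toPerm
    (fun p ↦ (cs.simple i * p.1 * cs.simple i, p.2 + if p.1 = cs.simple i then 1 else 0)) <| by
    rintro ⟨t, ε⟩
    have h : cs.simple i * t * cs.simple i = cs.simple i ↔ t = cs.simple i := by
      rw [mul_eq_right, ← mul_left_cancel_iff (a := cs.simple i)]
      simp
    have h2 : (1 : ZMod 2) + 1 = 0 := rfl
    ext1
    · simp [mul_assoc]
    · simp only [h]
      split_ifs <;> simp [add_assoc, h2]

variable {B W : Type*} [Group W] {M : CoxeterMatrix B} (cs : CoxeterSystem M W)

open scoped Classical in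
theorem inversionPerm_apply (i : B) (t : W) (ε : ZMod 2) :
    cs.inversionPerm i (t, ε) =
      (cs.simple i * t * cs.simple i, ε + if t = cs.simple i then 1 else 0) :=
  rfl

theorem simple_mul_pow_mul_simple (i j : B) (n : ℕ) :
    (cs.simple i * cs.simple j) ^ n * cs.simple j * (cs.simple i * cs.simple j) ^ n =
      cs.simple j := by
  induction n with
  | zero => simp
  | succ n ih =>
    nth_rw 1 [pow_succ]
    rw [pow_succ']
    calc _ = (cs.simple i * cs.simple j) ^ n * cs.simple i * cs.simple i * cs.simple j *
          (cs.simple i * cs.simple j) ^ n := by simp [mul_assoc]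
      _ = _ := by simpa using ih

open scoped Classical in
theorem inversionPerm_mul_pow_apply (i j : B) (n : ℕ) (t : W) (ε : ZMod 2) :
    ((cs.inversionPerm i * cs.inversionPerm j) ^ n) (t, ε) =
      ((cs.simple i * cs.simple j) ^ n * t * ((cs.simple i * cs.simple j) ^ n)⁻¹,
        ε + ∑ p ∈ Finset.range (2 * n),
          if t = cs.simple j * (cs.simple i * cs.simple j) ^ p then 1 else 0) := by
  induction n with
  | zero => simp
  | succ n ih =>
    set c := cs.simple i * cs.simple j with hc
    have hcn := cs.simple_mul_pow_mul_simple i j n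
    rw [← hc] at hcn
    clear_value c
    have h1 : c ^ n * t * (c ^ n)⁻¹ = cs.simple j ↔ t = cs.simple j * c ^ (2 * n) := by
      rw [mul_inv_eq_iff_eq_mul, ← mul_right_inj (c ^ n) (b := t), two_mul, pow_add, ← mul_assoc,
        ← mul_assoc, hcn]
    have h2 : cs.simple j * (c ^ n * t * (c ^ n)⁻¹) * cs.simple j = cs.simple i ↔
        t = cs.simple j * c ^ (2 * n + 1) := by
      have h (x : W) : cs.simple j * x * cs.simple j = cs.simple i ↔ x = cs.simple j * c := by
        rw [← mul_left_inj (cs.simple j), simple_mul_simple_cancel_right, ← hc,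
          ← mul_right_inj (cs.simple j), simple_mul_simple_cancel_left]
      rw [h, mul_inv_eq_iff_eq_mul, ← mul_right_inj (c ^ n) (b := t),
        show 2 * n + 1 = n + (n + 1) by ring, pow_add, ← mul_assoc, ← mul_assoc, hcn, pow_succ',
        ← mul_assoc]
    rw [pow_succ', Equiv.Perm.mul_apply, ih, Equiv.Perm.mul_apply, inversionPerm_apply,
      inversionPerm_apply, mul_add, mul_one, Finset.sum_range_succ, Finset.sum_range_succ]
    simp only [h1, h2]
    ext1
    · simp [pow_succ', hc, mul_assoc]
    · simp [add_assoc]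

theorem isLiftable_inversionPerm : M.IsLiftable cs.inversionPerm := by
  classical
  intro i j
  ext1 ⟨t, ε⟩
  rw [inversionPerm_mul_pow_apply, two_mul, Finset.sum_range_add]
  simp [pow_add, CharTwo.add_self_eq_zero]

/-- The action of `W` on `W × ZMod 2` that records the parity of inversion multiplicities. -/
noncomputable def inversionHom : W →* Equiv.Perm (W × ZMod 2) :=
  cs.lift ⟨cs.inversionPerm, cs.isLiftable_inversionPerm⟩

theorem inversionHom_simple (i : B) : cs.inversionHom (cs.simple i) = cs.inversionPerm i :=
  cs.lift_apply_simple cs.isLiftable_inversionPerm i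

/-- The parity of the multiplicity of `t` in the left inversion sequence of any word for `w`. -/
noncomputable def inversionParity (w t : W) : ZMod 2 := (cs.inversionHom w⁻¹ (t, 0)).2

theorem inversionHom_inv_apply (w t : W) (ε : ZMod 2) :
    cs.inversionHom w⁻¹ (t, ε) = (w⁻¹ * t * w, ε + cs.inversionParity w t) := by
  induction w using cs.simple_induction_left generalizing t ε with
  | one => simp [inversionParity]
  | mul_simple_left w i ih =>
    rw [inversionParity, mul_inv_rev, inv_simple, map_mul, Equiv.Perm.mul_apply,
      Equiv.Perm.mul_apply, inversionHom_simple, inversionPerm_apply, inversionPerm_apply, ih, ih]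
    simp [mul_assoc, add_assoc]

theorem inversionParity_mul (u v t : W) : cs.inversionParity (u * v) t =
    cs.inversionParity u t + cs.inversionParity v (u⁻¹ * t * u) := by
  rw [inversionParity, mul_inv_rev, map_mul, Equiv.Perm.mul_apply, inversionHom_inv_apply,
    inversionHom_inv_apply, zero_add]

open scoped Classical in
theorem inversionParity_simple (i : B) (t : W) :
    cs.inversionParity (cs.simple i) t = if t = cs.simple i then 1 else 0 := by
  simp [inversionParity, inversionHom_simple, inversionPerm_apply]

open scoped Classical in
theorem inversionParity_wordProd (ω : List B) (t : W) :
    cs.inversionParity (cs.wordProd ω) t = (cs.leftInvSeq ω).count t := by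
  induction ω generalizing t with
  | nil => simp [inversionParity]
  | cons i ω ih =>
    have ht : (cs.leftInvSeq ω).count (cs.simple i * t * cs.simple i) =
        ((cs.leftInvSeq ω).map (MulAut.conj (cs.simple i))).count t := by
      rw [← List.count_map_of_injective _ _ (MulAut.conj (cs.simple i)).injective]
      simp [mul_assoc]
    rw [wordProd_cons, inversionParity_mul, inversionParity_simple, ih, leftInvSeq,
      List.count_cons, inv_simple, ht]
    by_cases h : t = cs.simple i
    · simp [h, add_comm]
    · simp [h, Ne.symm h]

theorem length_mul_lt_of_inversionParity_ne_zero {w t : W} (h : cs.inversionParity w t ≠ 0) :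
    cs.length (t * w) < cs.length w := by
  classical
  obtain ⟨ω, hω, rfl⟩ := cs.exists_isReduced w
  refine (cs.isLeftInversion_of_mem_leftInvSeq hω ?_).2
  by_contra ht
  exact h (by rw [inversionParity_wordProd, List.count_eq_zero_of_not_mem ht, Nat.cast_zero])

theorem length_lt_of_inversionParity_eq_zero {w : W} {i : B}
    (h : cs.inversionParity w (cs.simple i) = 0) :
    cs.length w < cs.length (cs.simple i * w) := by
  have : cs.inversionParity (cs.simple i * w) (cs.simple i) ≠ 0 := by
    simp [inversionParity_mul, inversionParity_simple, h]
  simpa using cs.length_mul_lt_of_inversionParity_ne_zero this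

end InversionCocycle

section Dihedral

/-- The word of length `n` that alternates between `i` and `j`, starting with `i`. -/
def altWord {B : Type*} (i j : B) : ℕ → List B
  | 0 => []
  | n + 1 => i :: altWord j i n

variable {B W : Type*}

theorem altWord_eq (i j : B) (n : ℕ) :
    altWord i j n = if Even n then alternatingWord i j n else alternatingWord j i n := by
  induction n generalizing i j with
  | zero => simp [altWord, alternatingWord]
  | succ n ih =>
    rw [altWord, ih, alternatingWord_succ', alternatingWord_succ']
    by_cases h : Even n <;> simp [h, Nat.even_add_one]

theorem exists_altWord_succ (i j : B) (n : ℕ) :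
    ∃ k, altWord i j (n + 1) = altWord i j n ++ [k] := by
  induction n generalizing i j with
  | zero => exact ⟨i, rfl⟩
  | succ n ih =>
    obtain ⟨k, hk⟩ := ih j i
    exact ⟨k, by rw [altWord, hk, altWord, List.cons_append]⟩

theorem length_altWord (i j : B) (n : ℕ) : (altWord i j n).length = n := by
  induction n generalizing i j with
  | zero => rfl
  | succ n ih => simp [altWord, ih]

variable [Group W] {M : CoxeterMatrix B} (cs : CoxeterSystem M W)

theorem wordProd_altWord_comm (i j : B) :
    cs.wordProd (altWord i j (M i j)) = cs.wordProd (altWord j i (M i j)) := by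
  have h := cs.wordProd_braidWord_eq i j
  rw [braidWord, braidWord, M.symmetric j i] at h
  rw [altWord_eq, altWord_eq]
  split_ifs
  exacts [h, h.symm]

theorem exists_of_mem_leftInvSeq_altWord {i j : B} {n : ℕ} {t : W}
    (ht : t ∈ cs.leftInvSeq (altWord i j n)) :
    ∃ p < n, t = (cs.simple i * cs.simple j) ^ p * cs.simple i := by
  induction n generalizing i j t with
  | zero => simp [altWord] at ht
  | succ n ih =>
    rw [altWord, leftInvSeq, List.mem_cons, List.mem_map] at ht
    obtain rfl | ⟨u, hu, rfl⟩ := ht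
    · exact ⟨0, by simp⟩
    · obtain ⟨p, hp, rfl⟩ := ih hu
      refine ⟨p + 1, by omega, ?_⟩
      rw [MulAut.conj_apply, inv_simple, mul_pow_mul, pow_succ']
      simp [mul_assoc]

theorem inversionParity_wordProd_altWord {i j : B} (hij : i ≠ j) {n : ℕ}
    (hn : M i j = 0 ∨ n < M i j) :
    cs.inversionParity (cs.wordProd (altWord j i n)) (cs.simple i) = 0 := by
  classical
  rw [inversionParity_wordProd, List.count_eq_zero_of_not_mem, Nat.cast_zero]
  intro h
  obtain ⟨p, hp, h⟩ := cs.exists_of_mem_leftInvSeq_altWord h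
  rw [M.symmetric i j] at hn
  refine cs.simple_mul_simple_pow_ne_one hij.symm p.succ_pos (by omega) ?_
  rw [pow_succ, ← mul_assoc, ← h, simple_mul_simple_self]

theorem exists_altWord_of_mem_closure {i j : B} {x : W}
    (hx : x ∈ Subgroup.closure {cs.simple i, cs.simple j}) :
    ∃ n, (M i j = 0 ∨ n ≤ M i j) ∧
      (x = cs.wordProd (altWord i j n) ∨ x = cs.wordProd (altWord j i n)) := by
  have step (k l : B) (n : ℕ) (hn : M k l = 0 ∨ n ≤ M k l) (x : W)
      (hx : x = cs.wordProd (altWord k l n) ∨ x = cs.wordProd (altWord l k n)) :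
      ∃ n', (M k l = 0 ∨ n' ≤ M k l) ∧ (cs.simple k * x = cs.wordProd (altWord k l n') ∨
        cs.simple k * x = cs.wordProd (altWord l k n')) := by
    cases n with
    | zero =>
      by_cases h : M k l = 0 ∨ 1 ≤ M k l
      · exact ⟨1, h, Or.inl (by simpa [altWord] using hx)⟩
      · omega
    | succ n =>
      rcases hx with rfl | rfl
      · exact ⟨n, by omega, Or.inr (by simp [altWord, wordProd_cons])⟩
      · by_cases h : M k l = n + 1
        · refine ⟨n, by omega, Or.inr ?_⟩
          rw [← h, ← wordProd_altWord_comm, h]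
          simp [altWord, wordProd_cons]
        · exact ⟨n + 2, by omega, Or.inl (by simp only [altWord, wordProd_cons])⟩
  have step' (k : B) (hk : k = i ∨ k = j) (x : W)
      (h : ∃ n, (M i j = 0 ∨ n ≤ M i j) ∧
        (x = cs.wordProd (altWord i j n) ∨ x = cs.wordProd (altWord j i n))) :
      ∃ n, (M i j = 0 ∨ n ≤ M i j) ∧ (cs.simple k * x = cs.wordProd (altWord i j n) ∨
        cs.simple k * x = cs.wordProd (altWord j i n)) := by
    obtain ⟨n, hn, hx⟩ := h
    rcases hk with rfl | rfl
    · exact step k j n hn x hx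
    · obtain ⟨n', hn', h'⟩ := step k i n (by rwa [M.symmetric]) x hx.symm
      exact ⟨n', by rwa [M.symmetric], h'.symm⟩
  induction hx using Subgroup.closure_induction_left with
  | one => exact ⟨0, by simp [altWord]⟩
  | mul_left s hs x _ ih =>
    rcases hs with rfl | rfl
    exacts [step' i (Or.inl rfl) x ih, step' j (Or.inr rfl) x ih]
  | inv_mul_cancel s hs x _ ih =>
    rcases hs with rfl | rfl
    · simpa using step' i (Or.inl rfl) x ih
    · simpa using step' j (Or.inr rfl) x ih

theorem wordProd_altWord_mem_closure (i j : B) (n : ℕ) :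
    cs.wordProd (altWord i j n) ∈ Subgroup.closure {cs.simple i, cs.simple j} := by
  induction n generalizing i j with
  | zero => simp [altWord]
  | succ n ih =>
    rw [altWord, wordProd_cons]
    refine mul_mem (Subgroup.subset_closure (by simp)) ?_
    rw [Set.pair_comm]
    exact ih j i

theorem length_wordProd_altWord_mul {i j : B} (hij : i ≠ j) {y : W}
    (hy : ∀ x ∈ Subgroup.closure {cs.simple i, cs.simple j}, cs.length y ≤ cs.length (x * y))
    {n : ℕ} (hn : M i j = 0 ∨ n ≤ M i j) :
    cs.length (cs.wordProd (altWord i j n) * y) = n + cs.length y := by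
  induction n generalizing i j with
  | zero => simp [altWord]
  | succ n ih =>
    have hy' := hy
    rw [Set.pair_comm] at hy'
    have hlen := ih hij.symm hy' (by rw [M.symmetric]; omega)
    have hmem := wordProd_altWord_mem_closure cs j i n
    rw [Set.pair_comm] at hmem
    have hmin := hy _ (mul_mem (mul_mem (inv_mem hmem)
      (Subgroup.subset_closure (by simp : cs.simple i ∈ {cs.simple i, cs.simple j}))) hmem)
    have hlt : cs.length (cs.wordProd (altWord j i n) * y) <
        cs.length (cs.simple i * (cs.wordProd (altWord j i n) * y)) := by
      apply cs.length_lt_of_inversionParity_eq_zero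
      rw [inversionParity_mul, cs.inversionParity_wordProd_altWord hij (by omega), zero_add]
      by_contra h
      exact absurd (cs.length_mul_lt_of_inversionParity_ne_zero h) hmin.not_gt
    have := cs.length_simple_mul (cs.wordProd (altWord j i n) * y) i
    rw [altWord, wordProd_cons, mul_assoc]
    omega

/-- An element with two distinct left descents `i` and `j` is divisible by the longest element of
the dihedral parabolic subgroup generated by `i` and `j`, which is finite. -/
theorem exists_eq_wordProd_altWord_mul {w : W} {i j : B} (hij : i ≠ j)
    (hi : cs.IsLeftDescent w i) (hj : cs.IsLeftDescent w j) :
    M i j ≠ 0 ∧ ∃ y, w = cs.wordProd (altWord i j (M i j)) * y ∧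
      cs.length w = M i j + cs.length y := by
  obtain ⟨y, ⟨x, hx, hxy⟩, hmin⟩ := (measure cs.length).wf.has_min
    {y | ∃ x ∈ Subgroup.closure {cs.simple i, cs.simple j}, w = x * y} ⟨w, 1, one_mem _, by simp⟩
  have hy : ∀ x ∈ Subgroup.closure {cs.simple i, cs.simple j},
      cs.length y ≤ cs.length (x * y) := fun u hu ↦
    not_lt.1 (hmin (u * y) ⟨x * u⁻¹, mul_mem hx (inv_mem hu), by simp [hxy, mul_assoc]⟩)
  have hy' := hy
  rw [Set.pair_comm] at hy'
  have ascent {k l : B} (hkl : k ≠ l)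
      (hy : ∀ x ∈ Subgroup.closure {cs.simple k, cs.simple l}, cs.length y ≤ cs.length (x * y))
      (hk : cs.IsLeftDescent w k) {n : ℕ} (hw : w = cs.wordProd (altWord l k n) * y) :
      ¬ (M k l = 0 ∨ n < M k l) := by
    intro hn
    have h₁ := cs.length_wordProd_altWord_mul hkl hy (n := n + 1) (by omega)
    have hy' := hy
    rw [Set.pair_comm] at hy'
    have h₂ := cs.length_wordProd_altWord_mul hkl.symm hy' (n := n) (by rw [M.symmetric]; omega)
    rw [altWord, wordProd_cons, mul_assoc, ← hw] at h₁
    rw [← hw] at h₂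
    have : cs.length (cs.simple k * w) < cs.length w := hk
    omega
  obtain ⟨n, hn, hxn⟩ := cs.exists_altWord_of_mem_closure hx
  have hn' : ¬ (M i j = 0 ∨ n < M i j) := by
    rcases hxn with rfl | rfl
    · rw [M.symmetric]
      exact ascent hij.symm hy' hj hxy
    · exact ascent hij hy hi hxy
  obtain rfl : n = M i j := by omega
  have hxy' : w = cs.wordProd (altWord i j (M i j)) * y := by
    rcases hxn with rfl | rfl
    · exact hxy
    · rw [wordProd_altWord_comm]
      exact hxy
  refine ⟨by omega, y, hxy', ?_⟩
  nth_rw 1 [hxy']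
  exact cs.length_wordProd_altWord_mul hij hy hn

end Dihedral
end CoxeterSystem

theorem exists_braidWord_eq_altWord {B : Type} (M : CoxeterMatrix B) (i j : B) :
    ∃ p q, braidWord M p q = CoxeterSystem.altWord i j (M i j) ∧
      braidWord M q p = CoxeterSystem.altWord j i (M i j) := by
  simp only [CoxeterSystem.altWord_eq, braidWord]
  split_ifs
  · exact ⟨i, j, rfl, by rw [M.symmetric j i]⟩
  · exact ⟨j, i, by rw [M.symmetric j i], rfl⟩

open CoxeterSystem in
/-- The sweep for `z` can be carried out behind an arbitrary prefix `a`. -/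
theorem CoxeterSystem.exists_isReduced_sweepFrom {B W : Type} [Group W] {M : CoxeterMatrix B}
    (cs : CoxeterSystem M W) (z : W) (i j : B)
    (hij : cs.simple i * z = z * cs.simple j)
    (hup : cs.length (cs.simple i * z) = cs.length z + 1) :
    ∃ l : List B, cs.IsReduced l ∧ cs.wordProd l = z ∧
      ∀ a, SweepFrom M a (a ++ i :: l) (a ++ (l ++ [j])) := by
  induction hn : cs.length z using Nat.strong_induction_on generalizing z i with
  | _ N ih =>
  subst hn
  by_cases hz : z = 1
  · subst hz
    obtain rfl : i = j := cs.simple_injective (by simpa using hij)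
    refine ⟨[], by simp [IsReduced], by simp, fun a ↦ ?_⟩
    simpa [_root_.braidWord, alternatingWord] using SweepFrom.last (M := M) a i i
  obtain ⟨k, hk⟩ := cs.exists_leftDescent_of_ne_one hz
  have hkz := cs.isLeftDescent_iff.1 hk
  have hik : i ≠ k := by
    rintro rfl
    omega
  have hi : cs.IsLeftDescent (cs.simple i * z) i := by
    rw [isLeftDescent_iff, simple_mul_simple_cancel_left, hup]
  have hk' : cs.IsLeftDescent (cs.simple i * z) k := by
    have h := cs.length_mul_le (cs.simple k * z) (cs.simple j)
    rw [mul_assoc, ← hij, length_simple] at h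
    unfold IsLeftDescent
    omega
  obtain ⟨hM, y, hy, hlen⟩ := cs.exists_eq_wordProd_altWord_mul hik hi hk'
  obtain ⟨n, hn⟩ := Nat.exists_eq_succ_of_ne_zero hM
  have hM1 := M.off_diagonal i k hik
  obtain ⟨u, hu⟩ := exists_altWord_succ k i n
  have hzy : z = cs.wordProd (altWord k i n) * y := by
    rwa [hn, altWord, wordProd_cons, mul_assoc, mul_right_inj] at hy
  have huy : cs.simple u * y = y * cs.simple j := by
    rw [wordProd_altWord_comm, hn, hu, wordProd_append, wordProd_singleton, hij] at hy
    nth_rw 1 [hzy] at hy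
    rw [mul_assoc, mul_assoc, mul_right_inj] at hy
    exact hy.symm
  have hlu : cs.length (cs.simple u * y) = cs.length y + 1 := by
    have h₁ := cs.length_mul_le (cs.wordProd (altWord k i n)) (cs.simple u * y)
    have h₂ := cs.length_wordProd_le (altWord k i n)
    rw [length_altWord] at h₂
    rw [huy, ← mul_assoc, ← hzy, ← hij, ← huy] at h₁
    have := cs.length_simple_mul y u
    omega
  obtain ⟨l, hl, rfl, hsweep⟩ := ih _ (by omega) y u huy hlu rfl
  refine ⟨altWord k i n ++ l, ?_, by rw [wordProd_append, ← hzy], fun a ↦ ?_⟩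
  · have := hl.eq
    rw [IsReduced, wordProd_append, ← hzy, List.length_append, length_altWord]
    omega
  · obtain ⟨p, q, hpq, hqp⟩ := exists_braidWord_eq_altWord M i k
    rw [hn] at hpq hqp
    have h := SweepFrom.step (M := M) a l (a ++ (altWord k i n ++ l ++ [j])) p q
    rw [hpq, hqp, hu, ← List.append_assoc, List.dropLast_concat] at h
    simpa [altWord] using h (by simpa using hsweep (a ++ altWord k i n))

/-- If z ∈ W and s, t ∈ S satisfy s·z = z·t > z, then there is a reduced
expression z̃ of z such that (s, z̃) can be transformed into (z̃, t) by a sweep, i.e. a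
left-to-right sequence of single braid-relation applications ending at the end of the
word. -/
theorem stmt_13 {B W : Type} [Group W] {M : CoxeterMatrix B} (cs : CoxeterSystem M W)
    (z : W) (i j : B)
    (hij : cs.simple i * z = z * cs.simple j)
    (hup : cs.length (cs.simple i * z) = cs.length z + 1) :
    ∃ l : List B, cs.IsReduced l ∧ cs.wordProd l = z ∧
      SweepFrom M [] (i :: l) (l ++ [j]) := by
  obtain ⟨l, hl, hlz, h⟩ := cs.exists_isReduced_sweepFrom z i j hij hup
  exact ⟨l, hl, hlz, h []⟩
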